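/- arXiv:1812.10783 — 6 statements merged into one kernel-verified Lean document; each statement's English description precedes it below -/
import Mathlib

section
/- Let C be a nonempty closed subset of ℝⁿ. Then for Lebesgue-almost every x ∈ ℝⁿ, there exists a unique point y ∈ C such that ‖x − y‖ = inf_{z ∈ C} ‖x − z‖. -/
open MeasureTheory Metric

/-- If the distance function to `C` is differentiable at `x`, then the derivative of its square
at `x` is `2 ⟪x - y, ·⟫` for every nearest point `y` of `x` in `C`. -/
theorem hasFDerivAt_infDist_sq {E : Type*} [NormedAddCommGroup E] [InnerProductSpace ℝ E]
    {C : Set E} {x y : E} (hd : DifferentiableAt ℝ (infDist · C) x) (hy : y ∈ C)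
    (hxy : ‖x - y‖ = infDist x C) :
    HasFDerivAt (fun u => infDist u C ^ 2) (2 • innerSL ℝ (x - y)) x := by
  have hsq := (hd.pow 2).hasFDerivAt
  have hnorm : HasFDerivAt (fun u : E => ‖u - y‖ ^ 2) (2 • innerSL ℝ (x - y)) x := by
    simpa using ((hasFDerivAt_id x).sub_const y).norm_sq
  have hmin : IsLocalMin (fun u => ‖u - y‖ ^ 2 - infDist u C ^ 2) x := by
    refine Filter.Eventually.of_forall fun u => ?_
    have hle : infDist u C ≤ ‖u - y‖ := dist_eq_norm u y ▸ infDist_le_dist_of_mem hy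
    simpa [hxy] using pow_le_pow_left₀ infDist_nonneg hle 2
  rw [sub_eq_zero.mp (hmin.hasFDerivAt_eq_zero (hnorm.sub hsq))]
  exact hsq

/-- Nearest points are unique wherever the distance function is differentiable. -/
theorem nearest_point_unique_of_differentiableAt_infDist {E : Type*} [NormedAddCommGroup E]
    [InnerProductSpace ℝ E] {C : Set E} {x y z : E} (hd : DifferentiableAt ℝ (infDist · C) x)
    (hy : y ∈ C) (hxy : ‖x - y‖ = infDist x C) (hz : z ∈ C) (hxz : ‖x - z‖ = infDist x C) :
    y = z := by
  have h := (hasFDerivAt_infDist_sq hd hy hxy).unique (hasFDerivAt_infDist_sq hd hz hxz)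
  refine ext_inner_right ℝ fun v => ?_
  simpa using DFunLike.congr_fun h v

/-- For a nonempty closed `C ⊆ ℝⁿ`, almost every `x` has a unique nearest point in `C`. -/
theorem ae_existsUnique_nearest_point {n : ℕ}
    (C : Set (EuclideanSpace ℝ (Fin n))) (hC : IsClosed C) (hne : C.Nonempty) :
    ∀ᵐ x ∂(volume : Measure (EuclideanSpace ℝ (Fin n))),
      ∃! y, y ∈ C ∧ ‖x - y‖ = infDist x C := by
  filter_upwards [(lipschitz_infDist_pt C).ae_differentiableAt] with x hd
  obtain ⟨y, hy, hxy⟩ := hC.exists_infDist_eq_dist hne x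
  rw [dist_eq_norm] at hxy
  exact ⟨y, ⟨hy, hxy.symm⟩, fun z hz =>
    nearest_point_unique_of_differentiableAt_infDist hd hz.1 hz.2 hy hxy.symm⟩
end

section
/- Let C be a nonempty closed subset of ℝⁿ. Then there exist a Lebesgue-null set N ⊆ ℝⁿ and a function π : ℝⁿ → ℝⁿ such that for every x ∉ N one has π(x) ∈ C and ‖x − π(x)‖ = inf_{z ∈ C} ‖x − z‖, and π is continuous on the complement of N. -/
open MeasureTheory Metric

theorem eq_of_norm_sub_eq_infDist_of_differentiableAt {E : Type*} [NormedAddCommGroup E]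
    [InnerProductSpace ℝ E] {C : Set E} {x p q : E}
    (hd : DifferentiableAt ℝ (fun y => infDist y C) x)
    (hp : p ∈ C) (hpx : ‖x - p‖ = infDist x C)
    (hq : q ∈ C) (hqx : ‖x - q‖ = infDist x C) : p = q := by
  have key : ∀ r ∈ C, ‖x - r‖ = infDist x C →
      2 • (innerSL ℝ (x - r)) = fderiv ℝ (fun y => infDist y C ^ 2) x := by
    intro r hr hrx
    have hnorm : HasFDerivAt (fun y => ‖y - r‖ ^ 2) (2 • (innerSL ℝ (x - r))) x := by
      simpa using ((hasFDerivAt_id x).sub_const r).norm_sq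
    have hmin : IsLocalMin (fun y => ‖y - r‖ ^ 2 - infDist y C ^ 2) x := by
      refine Filter.Eventually.of_forall fun y => ?_
      have hy : infDist y C ≤ ‖y - r‖ := by
        simpa [dist_eq_norm] using infDist_le_dist_of_mem (x := y) hr
      have := pow_le_pow_left₀ infDist_nonneg hy 2
      simp only [hrx, sub_self]
      linarith
    exact sub_eq_zero.mp (hmin.hasFDerivAt_eq_zero (hnorm.sub (hd.pow 2).hasFDerivAt))
  have h := congrArg (fun L => L (q - p)) ((key p hp hpx).trans (key q hq hqx).symm)
  have h' : inner ℝ p (q - p) = inner ℝ q (q - p) := by simpa using h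
  have h_self : inner ℝ (q - p) (q - p) = 0 := by rw [inner_sub_left, h', sub_self]
  exact (sub_eq_zero.mp (inner_self_eq_zero.mp h_self)).symm

theorem continuousOn_of_unique_metric_projection {X : Type*} [MetricSpace X] [ProperSpace X]
    {C S : Set X} (hC : IsClosed C) {π : X → X}
    (hπ : ∀ x ∈ S, π x ∈ C ∧ dist x (π x) = infDist x C)
    (huniq : ∀ x ∈ S, ∀ p ∈ C, dist x p = infDist x C → p = π x) : ContinuousOn π S := by
  intro x hx
  refine (isCompact_closedBall x (infDist x C + 2)).tendsto_nhds_of_unique_mapClusterPt ?_ ?_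
  · filter_upwards [self_mem_nhdsWithin, nhdsWithin_le_nhds (ball_mem_nhds x one_pos)] with y hy hyx
    rw [mem_ball] at hyx
    have h₁ : infDist y C ≤ infDist x C + dist y x := infDist_le_infDist_add_dist
    have h₂ := dist_triangle x y (π y)
    rw [(hπ y hy).2, dist_comm x y] at h₂
    rw [mem_closedBall, dist_comm]
    linarith
  · intro p _ hp
    obtain ⟨U, hU, hUp⟩ := mapClusterPt_iff_ultrafilter.mp hp
    have hUS : ∀ᶠ y in (U : Filter X), y ∈ S := hU self_mem_nhdsWithin
    have hUx : Filter.Tendsto id (U : Filter X) (nhds x) := hU.trans nhdsWithin_le_nhds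
    refine huniq x hx p (hC.mem_of_tendsto hUp (hUS.mono fun y hy => (hπ y hy).1)) ?_
    refine tendsto_nhds_unique (hUx.dist hUp)
      ((((continuous_infDist_pt C).tendsto x).comp hUx).congr' ?_)
    filter_upwards [hUS] with y hy using (hπ y hy).2.symm

/-- For a nonempty closed `C ⊆ ℝⁿ` there is a null set `N` and a metric projection
`π : ℝⁿ → ℝⁿ` defined off `N`, continuous on the complement of `N`. -/
theorem exists_metric_projection_ae_continuous {n : ℕ}
    (C : Set (EuclideanSpace ℝ (Fin n))) (hC : IsClosed C) (hne : C.Nonempty) :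
    ∃ (N : Set (EuclideanSpace ℝ (Fin n)))
      (π : EuclideanSpace ℝ (Fin n) → EuclideanSpace ℝ (Fin n)),
      volume N = 0 ∧
      (∀ x ∉ N, π x ∈ C ∧ ‖x - π x‖ = infDist x C) ∧
      ContinuousOn π Nᶜ := by
  choose π hπC hπ using fun x => hC.exists_infDist_eq_dist hne x
  refine ⟨{x | ¬ DifferentiableAt ℝ (fun y => infDist y C) x}, π,
    ae_iff.mp (lipschitz_infDist_pt C).ae_differentiableAt,
    fun x _ => ⟨hπC x, by rw [hπ, dist_eq_norm]⟩,
    continuousOn_of_unique_metric_projection hC (fun x _ => ⟨hπC x, (hπ x).symm⟩) ?_⟩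
  intro x hx p hp hpx
  exact eq_of_norm_sub_eq_infDist_of_differentiableAt (not_not.mp hx) hp
    (by rw [← dist_eq_norm, hpx]) (hπC x) (by rw [← dist_eq_norm, hπ])
end

section
/- Let C be a nonempty closed subset of Euclidean space ℝⁿ, let x ∉ C, let y ∈ C satisfy ‖x − y‖ = inf_{z ∈ C} ‖x − z‖, and suppose the distance function d_C(z) := inf_{w ∈ C} ‖z − w‖ is differentiable at x. Then the gradient of d_C at x equals (x − y)/‖x − y‖. -/
open Metric

/-- Away from the origin, the gradient of `z ↦ ‖z - y‖` is the unit vector pointing from `y`. -/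
theorem hasGradientAt_norm_sub {F : Type*} [NormedAddCommGroup F] [InnerProductSpace ℝ F]
    [CompleteSpace F] {x y : F} (hxy : x ≠ y) :
    HasGradientAt (fun z => ‖z - y‖) (‖x - y‖⁻¹ • (x - y)) x := by
  have hpos : 0 < ‖x - y‖ := norm_pos_iff.2 (sub_ne_zero.2 hxy)
  have hsq : HasFDerivAt (fun z => ‖z - y‖ ^ 2) _ x := ((hasFDerivAt_id x).sub_const y).norm_sq
  have hnorm := hsq.sqrt (pow_pos hpos 2).ne'
  simp only [Real.sqrt_sq (norm_nonneg _)] at hnorm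
  rw [hasGradientAt_iff_hasFDerivAt]
  refine hnorm.congr_fderiv ?_
  ext v
  simp
  field_simp

/-- If the distance function to a nonempty closed set `C ⊆ ℝⁿ` is differentiable at `x ∉ C`
and `y ∈ C` is a nearest point to `x`, then `∇ d_C(x) = (x - y) / ‖x - y‖`. -/
theorem gradient_infDist_eq {n : ℕ}
    (C : Set (EuclideanSpace ℝ (Fin n))) (hC : IsClosed C) (hne : C.Nonempty)
    (x : EuclideanSpace ℝ (Fin n)) (hx : x ∉ C)
    (y : EuclideanSpace ℝ (Fin n)) (hy : y ∈ C) (hmin : ‖x - y‖ = infDist x C)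
    (hdiff : DifferentiableAt ℝ (fun z => infDist z C) x) :
    gradient (fun z => infDist z C) x = ‖x - y‖⁻¹ • (x - y) := by
  have hxy : x ≠ y := fun h => hx (h ▸ hy)
  have hnorm := (hasGradientAt_norm_sub hxy).hasFDerivAt
  have hlocal : IsLocalMin (fun z => ‖z - y‖ - infDist z C) x :=
    Filter.Eventually.of_forall fun z => by
      have hz := infDist_le_dist_of_mem (x := z) hy
      rw [dist_eq_norm] at hz
      simp only [hmin, sub_self]
      exact sub_nonneg.2 hz
  have hzero := hlocal.hasFDerivAt_eq_zero (hnorm.sub hdiff.hasGradientAt.hasFDerivAt)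
  exact ((InnerProductSpace.toDual ℝ _).injective (sub_eq_zero.1 hzero)).symm
end

section
/- Let C be a nonempty closed subset of Euclidean space ℝⁿ, let x ∉ C, and suppose the distance function d_C(z) := inf_{w ∈ C} ‖z − w‖ is differentiable at x. Then there is exactly one point y ∈ C with ‖x − y‖ = d_C(x). -/
open Metric

/-- If the distance function to `C` is differentiable at `x` and `y` is a nearest point of `C`
to `x`, then `x - y` represents `infDist x C` times the derivative of the distance function. -/
theorem inner_sub_eq_infDist_mul_fderiv {E : Type*} [NormedAddCommGroup E]
    [InnerProductSpace ℝ E] {C : Set E} {x y : E} (hy : y ∈ C) (hxy : ‖x - y‖ = infDist x C)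
    (hdiff : DifferentiableAt ℝ (fun z => infDist z C) x) (v : E) :
    inner ℝ (x - y) v = infDist x C * fderiv ℝ (fun z => infDist z C) x v := by
  have hmin : IsLocalMin (fun z => ‖z - y‖ ^ 2 - infDist z C ^ 2) x := by
    refine Filter.Eventually.of_forall fun z => ?_
    have hz : infDist z C ≤ ‖z - y‖ := by
      simpa [dist_eq_norm] using infDist_le_dist_of_mem (x := z) hy
    have hz_sq := pow_le_pow_left₀ infDist_nonneg hz 2
    simpa [hxy] using hz_sq
  have hderiv := (((hasFDerivAt_id x).sub_const y).norm_sq).sub (hdiff.hasFDerivAt.pow 2)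
  have hzero := DFunLike.congr_fun (hmin.hasFDerivAt_eq_zero hderiv) v
  simp [inner_sub_left] at hzero ⊢
  linarith

/-- If the distance function to a nonempty closed set `C ⊆ ℝⁿ` is differentiable at `x ∉ C`,
then `x` has exactly one nearest point in `C`. -/
theorem existsUnique_nearest_point_of_differentiableAt {n : ℕ}
    (C : Set (EuclideanSpace ℝ (Fin n))) (hC : IsClosed C) (hne : C.Nonempty)
    (x : EuclideanSpace ℝ (Fin n)) (hx : x ∉ C)
    (hdiff : DifferentiableAt ℝ (fun z => infDist z C) x) :
    ∃! y, y ∈ C ∧ ‖x - y‖ = infDist x C := by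
  obtain ⟨y, hy, hxy⟩ := hC.exists_infDist_eq_dist hne x
  rw [dist_eq_norm] at hxy
  refine ⟨y, ⟨hy, hxy.symm⟩, fun w ⟨hw, hxw⟩ => ?_⟩
  have hsub : x - w = x - y := ext_inner_right ℝ fun v => by
    rw [inner_sub_eq_infDist_mul_fderiv hw hxw hdiff,
      inner_sub_eq_infDist_mul_fderiv hy hxy.symm hdiff]
  exact sub_right_injective hsub
end

section
/- Let C be a nonempty closed subset of Euclidean space ℝⁿ, let x ∉ C, suppose the distance function d_C(z) := inf_{w ∈ C} ‖z − w‖ is differentiable at x, and let y ∈ C be a point with ‖x − y‖ = d_C(x). Then y = x − d_C(x) · ∇d_C(x), where ∇d_C(x) is the gradient of d_C at x. -/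
open Metric

/-- If the distance function to a nonempty closed set `C ⊆ ℝⁿ` is differentiable at `x ∉ C`
and `y ∈ C` is a nearest point to `x`, then `y = x - d_C(x) • ∇d_C(x)`. -/
theorem nearest_point_eq_sub_infDist_smul_gradient {n : ℕ}
    (C : Set (EuclideanSpace ℝ (Fin n))) (hC : IsClosed C) (hne : C.Nonempty)
    (x : EuclideanSpace ℝ (Fin n)) (hx : x ∉ C)
    (hdiff : DifferentiableAt ℝ (fun z => infDist z C) x)
    (y : EuclideanSpace ℝ (Fin n)) (hy : y ∈ C) (hmin : ‖x - y‖ = infDist x C) :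
    y = x - infDist x C • gradient (fun z => infDist z C) x := by
  have hloc : IsLocalMin (fun z => ‖z - y‖ ^ 2 - infDist z C ^ 2) x := by
    refine Filter.Eventually.of_forall fun z => ?_
    have hz : infDist z C ≤ ‖z - y‖ := by
      simpa [dist_eq_norm] using infDist_le_dist_of_mem (x := z) hy
    have hsq := pow_le_pow_left₀ infDist_nonneg hz 2
    simpa [hmin] using hsq
  have hderiv := (((hasFDerivAt_id x).sub_const y).norm_sq).sub (hdiff.hasFDerivAt.pow 2)
  have hzero := hloc.hasFDerivAt_eq_zero hderiv
  have hsub : x - y = infDist x C • gradient (fun z => infDist z C) x := by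
    refine ext_inner_right ℝ fun v => ?_
    have hv := congrArg (fun L => L v) hzero
    have hgrad : inner ℝ (gradient (fun z => infDist z C) x) v =
        fderiv ℝ (fun z => infDist z C) x v := by
      rw [← toDual_gradient, InnerProductSpace.toDual_apply_apply]
    simp at hv
    rw [real_inner_smul_left, hgrad, inner_sub_left]
    linarith
  rw [← hsub, sub_sub_cancel]
end

section
/- There is no topological embedding of SO(3) into S² × S¹, where SO(3) is the group of 3×3 real orthogonal matrices of determinant 1 with the subspace topology from the space of 3×3 real matrices, S² = {x ∈ ℝ³ : ‖x‖ = 1}, and S¹ = {x ∈ ℝ² : ‖x‖ = 1}. -/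
open Matrix

/-- `SO(3)`: the 3×3 real matrices `A` with `Aᵀ * A = 1` and `det A = 1`, topologized as a
subspace of the space of 3×3 real matrices. -/
def SO3 : Type := {A : Matrix (Fin 3) (Fin 3) ℝ // Aᵀ * A = 1 ∧ A.det = 1}

instance : TopologicalSpace SO3 :=
  instTopologicalSpaceSubtype

open Set Metric MeasureTheory Polynomial

/-- Lagrange interpolation for the polynomial `t ↦ det (1 + t • A)`. -/
theorem exists_det_one_add_eq_sum {E : Type*} [NormedAddCommGroup E] [NormedSpace ℝ E]
    [FiniteDimensional ℝ E] (t : Fin (Module.finrank ℝ E + 1) → ℝ)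
    (ht : Function.Injective t) :
    ∃ c : Fin (Module.finrank ℝ E + 1) → ℝ, ∀ A : E →L[ℝ] E,
      (1 + A).det = ∑ i, c i * (1 + t i • A).det := by
  classical
  refine ⟨fun i => (Lagrange.basis Finset.univ t i).eval 1, fun A => ?_⟩
  let b := Module.finBasis ℝ E
  let M := LinearMap.toMatrix b b A
  let p : ℝ[X] := ((X : ℝ[X]) • M.map C + (1 : Matrix _ _ ℝ).map C).det
  have hp : ∀ s : ℝ, (1 + s • A).det = p.eval s := by
    intro s
    have h1 : LinearMap.toMatrix b b ((1 + s • A : E →L[ℝ] E) : E →ₗ[ℝ] E) = s • M + 1 := by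
      have : ((1 + s • A : E →L[ℝ] E) : E →ₗ[ℝ] E) = LinearMap.id + s • (A : E →ₗ[ℝ] E) := by
        ext; simp
      rw [this, map_add, map_smul, LinearMap.toMatrix_id, add_comm]
    rw [ContinuousLinearMap.det, ← LinearMap.det_toMatrix b, h1]
    simp only [p, ← Polynomial.coe_evalRingHom, RingHom.map_det]
    congr 1
    ext i j
    rcases eq_or_ne i j with rfl | hij
    · simp; ring
    · simp [hij]; ring
  have hdeg : p.degree < (Finset.univ : Finset (Fin (Module.finrank ℝ E + 1))).card := by
    rw [Finset.card_univ, Fintype.card_fin]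
    refine lt_of_le_of_lt Polynomial.degree_le_natDegree ?_
    have := Polynomial.natDegree_det_X_add_C_le M 1
    rw [Fintype.card_fin] at this
    exact_mod_cast Nat.lt_succ_of_le this
  have h := Lagrange.eq_interpolate (s := Finset.univ) (v := t) ht.injOn hdeg
  have h1 := hp 1
  rw [one_smul] at h1
  rw [h1, h, Lagrange.interpolate_apply, Polynomial.eval_finsetSum]
  refine Finset.sum_congr rfl fun i _ => ?_
  rw [hp, Polynomial.eval_mul, Polynomial.eval_C, mul_comm]

theorem det_one_add_pos {E : Type*} [NormedAddCommGroup E] [NormedSpace ℝ E]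
    [FiniteDimensional ℝ E] (B : E →L[ℝ] E) (hB : ‖B‖ < 1) : 0 < (1 + B).det := by
  have hne : ∀ s ∈ Icc (0 : ℝ) 1, (1 + s • B).det ≠ 0 := by
    intro s hs h0
    obtain ⟨v, hv, hv0⟩ := (Submodule.ne_bot_iff _).1
      (LinearMap.bot_lt_ker_of_det_eq_zero (f := ((1 + s • B : E →L[ℝ] E) : E →ₗ[ℝ] E)) h0).ne'
    have h1 : v = -(s • B v) := by
      have : v + s • B v = 0 := by simpa using hv
      exact eq_neg_of_add_eq_zero_left this
    have h2 : ‖v‖ ≤ ‖B‖ * ‖v‖ := by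
      calc ‖v‖ = |s| * ‖B v‖ := by
            conv_lhs => rw [h1]
            rw [norm_neg, norm_smul, Real.norm_eq_abs]
        _ ≤ 1 * ‖B v‖ := by
            gcongr
            rw [abs_of_nonneg hs.1]; exact hs.2
        _ ≤ ‖B‖ * ‖v‖ := by rw [one_mul]; exact B.le_opNorm v
    nlinarith [norm_pos_iff.2 hv0]
  have hc : Continuous fun s : ℝ => (1 + s • B).det :=
    ContinuousLinearMap.continuous_det.comp (by fun_prop)
  by_contra! hle
  obtain ⟨s, hs, hs0⟩ := intermediate_value_Icc' (zero_le_one (α := ℝ)) hc.continuousOn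
    (show (0 : ℝ) ∈ Icc _ _ by
      constructor
      · simpa using hle
      · simp [ContinuousLinearMap.det])
  exact hne s hs hs0

theorem volume_ball_eq_setIntegral_det {E : Type*} [NormedAddCommGroup E] [NormedSpace ℝ E]
    [FiniteDimensional ℝ E] [MeasurableSpace E] [BorelSpace E] (μ : Measure E)
    [μ.IsAddHaarMeasure] {ρ : ℝ} {K : NNReal} {g : E → E} {g' : E → E →L[ℝ] E}
    (hg : LipschitzWith K g) (hK : K < 1) (hout : ∀ x, ρ ≤ ‖x‖ → g x = 0)
    (hd : ∀ x ∈ ball (0 : E) ρ, HasFDerivAt g (g' x) x) :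
    IntegrableOn (fun x => (1 + g' x).det) (ball 0 ρ) μ ∧
      ∫ x in ball (0 : E) ρ, (1 + g' x).det ∂μ = μ.real (ball 0 ρ) := by
  let φ : E → E := fun x => x + g x
  have happ : ApproximatesLinearOn φ ((ContinuousLinearEquiv.refl ℝ E : E ≃L[ℝ] E) : E →L[ℝ] E)
      univ K := by
    intro x _ y _
    have := hg.dist_le_mul x y
    rw [dist_eq_norm, dist_eq_norm] at this
    simpa [φ, add_sub_add_comm] using this
  have hc : Subsingleton E ∨
      K < ‖((ContinuousLinearEquiv.refl ℝ E).symm : E →L[ℝ] E)‖₊⁻¹ := by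
    rcases subsingleton_or_nontrivial E with h | h
    · exact Or.inl h
    · right
      have : ‖((ContinuousLinearEquiv.refl ℝ E).symm : E →L[ℝ] E)‖₊ = 1 := by
        ext; exact ContinuousLinearMap.norm_id
      rw [this, inv_one]; exact hK
  have hbij : Function.Bijective φ := (happ.toHomeomorph φ hc).bijective
  have himg : φ '' ball 0 ρ = ball 0 ρ := by
    have hfix : ∀ x, ρ ≤ ‖x‖ → φ x = x := fun x hx => by simp [φ, hout x hx]
    ext y
    constructor
    · rintro ⟨x, hx, rfl⟩
      by_contra hy
      rw [mem_ball_zero_iff, not_lt] at hy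
      rw [hbij.1 (hfix _ hy)] at hy
      exact absurd (mem_ball_zero_iff.1 hx) (not_lt.2 hy)
    · intro hy
      obtain ⟨x, rfl⟩ := hbij.2 y
      refine ⟨x, ?_, rfl⟩
      by_contra hx
      rw [mem_ball_zero_iff, not_lt] at hx
      rw [hfix x hx] at hy
      exact absurd (mem_ball_zero_iff.1 hy) (not_lt.2 hx)
  have hφ : ∀ x ∈ ball (0 : E) ρ, HasFDerivWithinAt φ (1 + g' x) (ball 0 ρ) x :=
    fun x hx => ((hasFDerivAt_id x).add (hd x hx)).hasFDerivWithinAt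
  have hpos : ∀ x ∈ ball (0 : E) ρ, |(1 + g' x).det| • (1 : ℝ) = (1 + g' x).det := by
    intro x hx
    rw [smul_eq_mul, mul_one, abs_of_pos]
    refine det_one_add_pos _ (lt_of_le_of_lt ?_ (show (K : ℝ) < 1 by exact_mod_cast hK))
    exact (hd x hx).le_of_lipschitz hg
  have hfin : IntegrableOn (fun _ : E => (1 : ℝ)) (φ '' ball 0 ρ) μ := by
    rw [himg]; exact integrableOn_const measure_ball_lt_top.ne
  have h1 := (integrableOn_image_iff_integrableOn_abs_det_fderiv_smul μ measurableSet_ball hφ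
    hbij.1.injOn (fun _ => (1 : ℝ))).1 hfin
  have h2 := integral_image_eq_integral_abs_det_fderiv_smul μ measurableSet_ball hφ
    hbij.1.injOn (fun _ => (1 : ℝ))
  refine ⟨h1.congr_fun hpos measurableSet_ball, ?_⟩
  rw [← setIntegral_congr_fun measurableSet_ball hpos, ← h2, himg]
  simp

theorem exists_lipschitzWith_eqOn_closedBall {E : Type*} [NormedAddCommGroup E] [NormedSpace ℝ E]
    {ρ : ℝ} (hρ : 0 < ρ) {K : NNReal} {g : E → E} (hg : LipschitzOnWith K g (closedBall 0 ρ))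
    (h0 : ∀ x, ‖x‖ = ρ → g x = 0) :
    ∃ G : E → E, LipschitzWith K G ∧ EqOn G g (closedBall 0 ρ) ∧ ∀ x, ρ ≤ ‖x‖ → G x = 0 := by
  classical
  have key : ∀ x y, ‖x‖ ≤ ρ → ρ < ‖y‖ → ‖g x‖ ≤ K * ‖x - y‖ := by
    intro x y hx hy
    have haux : ∀ z, ‖z‖ = ρ → ‖x - z‖ ≤ ‖x - y‖ → ‖g x‖ ≤ K * ‖x - y‖ := by
      intro z hz hxz
      have := hg.dist_le_mul x (by simpa using hx) z (by simp [hz])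
      rw [h0 z hz, dist_zero_right, dist_eq_norm] at this
      exact this.trans (by gcongr)
    rcases eq_or_ne x 0 with rfl | hx0
    · have hy0 : ‖y‖ ≠ 0 := (hρ.trans hy).ne'
      have hz : ‖(ρ / ‖y‖) • y‖ = ρ := by
        rw [norm_smul, Real.norm_of_nonneg (by positivity), div_mul_cancel₀ _ hy0]
      exact haux _ hz (by simpa [hz] using hy.le)
    · have hx0' : ‖x‖ ≠ 0 := norm_ne_zero_iff.2 hx0
      refine haux ((ρ / ‖x‖) • x) ?_ ?_
      · rw [norm_smul, Real.norm_of_nonneg (by positivity), div_mul_cancel₀ _ hx0']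
      · have : x - (ρ / ‖x‖) • x = -((ρ / ‖x‖ - 1) • x) := by module
        rw [this, norm_neg, norm_smul, Real.norm_of_nonneg, sub_mul, div_mul_cancel₀ _ hx0',
          norm_sub_rev]
        · linarith [norm_sub_norm_le y x]
        · rw [sub_nonneg, le_div_iff₀ (by positivity)]; simpa using hx
  refine ⟨fun x => if ‖x‖ ≤ ρ then g x else 0, ?_, ?_, ?_⟩
  · refine LipschitzWith.of_dist_le_mul fun x y => ?_
    rw [dist_eq_norm, dist_eq_norm]
    split_ifs with hx hy hy
    · simpa [dist_eq_norm] using hg.dist_le_mul x (by simpa using hx) y (by simpa using hy)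
    · simpa using key x y hx (not_le.1 hy)
    · rw [norm_sub_rev x y]
      simpa using key y x hy (not_le.1 hx)
    · simp; positivity
  · intro x hx
    simp [mem_closedBall_zero_iff.1 hx]
  · intro x hx
    dsimp only
    split_ifs with h
    · exact h0 x (le_antisymm h hx)
    · rfl

/-- There is no `C¹` retraction of a ball onto its boundary sphere. -/
theorem no_contDiff_retraction {E : Type*} [NormedAddCommGroup E] [InnerProductSpace ℝ E]
    [FiniteDimensional ℝ E] {ρ : ℝ} (hρ : 0 < ρ) {r : E → E} (hr : ContDiff ℝ 1 r)
    (hnorm : ∀ x, ‖r x‖ = ρ) (hfix : ∀ x, ‖x‖ = ρ → r x = x) : False := by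
  let : MeasurableSpace E := borel E
  have : BorelSpace E := ⟨rfl⟩
  have hg : ContDiff ℝ 1 (fun x => r x - x) := hr.sub contDiff_id
  set g : E → E := fun x => r x - x with hgdef
  obtain ⟨K, hK⟩ : ∃ K : NNReal, LipschitzOnWith K g (closedBall 0 ρ) := by
    obtain ⟨C, hC⟩ := (isCompact_closedBall (0 : E) ρ).exists_bound_of_continuousOn
      (hg.continuous_fderiv one_ne_zero).continuousOn
    refine ⟨C.toNNReal, (convex_closedBall 0 ρ).lipschitzOnWith_of_nnnorm_fderiv_le
      (fun x _ => (hg.differentiable one_ne_zero).differentiableAt) fun x hx => ?_⟩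
    rw [← NNReal.coe_le_coe]
    exact (hC x hx).trans (Real.le_coe_toNNReal C)
  obtain ⟨G, hGlip, hGeq, hGout⟩ := exists_lipschitzWith_eqOn_closedBall hρ hK
    (fun x hx => by simp [hgdef, hfix x hx])
  have hGd : ∀ x ∈ ball (0 : E) ρ, HasFDerivAt G (fderiv ℝ g x) x := by
    intro x hx
    refine ((hg.differentiable one_ne_zero) x).hasFDerivAt.congr_of_eventuallyEq ?_
    filter_upwards [isOpen_ball.mem_nhds hx] with y hy
    exact hGeq (ball_subset_closedBall hy)
  let t : Fin (Module.finrank ℝ E + 1) → ℝ := fun i => ((K : ℝ) + 1 + i)⁻¹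
  have ht0 : ∀ i, 0 < t i := fun i => by positivity
  have htinj : Function.Injective t := by
    intro i j hij
    have := inv_injective hij
    exact Fin.ext (by exact_mod_cast add_left_cancel this)
  obtain ⟨c, hc⟩ := exists_det_one_add_eq_sum (E := E) t htinj
  have hI : ∀ i, IntegrableOn (fun x => (1 + t i • fderiv ℝ g x).det) (ball 0 ρ) volume ∧
      ∫ x in ball (0 : E) ρ, (1 + t i • fderiv ℝ g x).det = volume.real (ball (0 : E) ρ) := by
    intro i
    refine volume_ball_eq_setIntegral_det volume (K := (t i).toNNReal * K)
      (g := fun x => t i • G x) ?_ ?_ ?_ ?_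
    · refine LipschitzWith.of_dist_le_mul fun x y => ?_
      rw [dist_smul₀, Real.norm_of_nonneg (ht0 i).le, NNReal.coe_mul,
        Real.coe_toNNReal _ (ht0 i).le, mul_assoc]
      exact mul_le_mul_of_nonneg_left (hGlip.dist_le_mul x y) (ht0 i).le
    · rw [← NNReal.coe_lt_coe, NNReal.coe_mul, Real.coe_toNNReal _ (ht0 i).le, NNReal.coe_one]
      simp only [t]
      rw [inv_mul_lt_iff₀ (by positivity)]
      have : (0 : ℝ) ≤ (i : ℕ) := by positivity
      linarith
    · intro x hx
      simp [hGout x hx]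
    · intro x hx
      exact (hGd x hx).const_smul (t i)
  have hsum : ∑ i, c i = 1 := by
    have := hc 0
    simpa [ContinuousLinearMap.det] using this.symm
  have hdet : ∀ x, (1 + fderiv ℝ g x).det = 0 := by
    intro x
    have hrd : HasFDerivAt r (1 + fderiv ℝ g x) x := by
      have h := (hasFDerivAt_id x).add ((hg.differentiable one_ne_zero) x).hasFDerivAt
      refine h.congr_of_eventuallyEq (Filter.Eventually.of_forall fun y => ?_)
      simp [hgdef]
    by_contra hne
    have hunit : IsUnit (((1 + fderiv ℝ g x : E →L[ℝ] E) : E →ₗ[ℝ] E)).det :=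
      isUnit_iff_ne_zero.2 hne
    obtain ⟨v, hv⟩ :=
      ((Module.End.isUnit_iff _).1 ((LinearMap.isUnit_iff_isUnit_det _).2 hunit)).2 (r x)
    have hv' : (1 + fderiv ℝ g x) v = r x := hv
    have h1 : HasFDerivAt (fun y => inner ℝ (r y) (r y)) _ x := hrd.inner ℝ hrd
    have h2 : (fun y => inner ℝ (r y) (r y)) = fun _ => ρ ^ 2 := by
      funext y; rw [real_inner_self_eq_norm_sq, hnorm]
    rw [h2] at h1
    have h3 := congrArg (fun L => L v) (h1.unique (hasFDerivAt_const _ x))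
    simp only [ContinuousLinearMap.comp_apply, ContinuousLinearMap.prod_apply,
      fderivInnerCLM_apply, hv', real_inner_self_eq_norm_sq, hnorm] at h3
    have : ρ ^ 2 + ρ ^ 2 = 0 := h3
    nlinarith
  have hvol : (0 : ℝ) = volume.real (ball (0 : E) ρ) := by
    calc (0 : ℝ) = ∫ x in ball (0 : E) ρ, (1 + fderiv ℝ g x).det := by simp [hdet]
      _ = ∫ x in ball (0 : E) ρ, ∑ i, c i * (1 + t i • fderiv ℝ g x).det := by
          congr 1; funext x; exact hc _
      _ = ∑ i, c i * volume.real (ball (0 : E) ρ) := by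
          rw [integral_finsetSum _ fun i _ => (hI i).1.const_mul (c i)]
          simp_rw [integral_const_mul, (hI _).2]
      _ = _ := by rw [← Finset.sum_mul, hsum, one_mul]
  exact (ENNReal.toReal_pos (measure_ball_pos volume (0 : E) hρ).ne'
    measure_ball_lt_top.ne).ne hvol

/-- **Brouwer's fixed point theorem** for bounded maps of a Euclidean space to itself. -/
theorem exists_fixedPoint_of_bounded {E : Type*} [NormedAddCommGroup E] [InnerProductSpace ℝ E]
    [FiniteDimensional ℝ E] {f : E → E} (hf : Continuous f) {C : ℝ} (hC : ∀ x, ‖f x‖ ≤ C) :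
    ∃ x, f x = x := by
  by_contra! hne
  have hC0 : 0 ≤ C := (norm_nonneg _).trans (hC 0)
  obtain ⟨δ, hδ0, hδ⟩ : ∃ δ > 0, ∀ x ∈ closedBall (0 : E) (C + 1), δ ≤ ‖f x - x‖ := by
    obtain ⟨x₀, -, hx₀⟩ := (isCompact_closedBall (0 : E) (C + 1)).exists_isMinOn
      ⟨0, by simpa using by linarith⟩ (f := fun x => ‖f x - x‖) (by fun_prop)
    exact ⟨_, norm_pos_iff.2 (sub_ne_zero.2 (hne x₀)), fun x hx => hx₀ hx⟩
  obtain ⟨q, hq, hqf, -⟩ := hf.exists_contDiff_approx 1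
    (ε := fun _ => min δ 1) continuous_const (fun _ => by positivity)
  simp only [dist_eq_norm, lt_min_iff] at hqf
  have hqC : ∀ x, ‖q x‖ ≤ C + 1 := by
    intro x
    calc ‖q x‖ = ‖(q x - f x) + f x‖ := by simp
      _ ≤ ‖q x - f x‖ + ‖f x‖ := norm_add_le _ _
      _ ≤ C + 1 := by linarith [(hqf x).2, hC x]
  let χ : ContDiffBump (0 : E) := ⟨C + 1, 2 * (C + 1), by linarith, by linarith⟩
  let h : E → E := fun x => x - χ x • q x
  have hh : ContDiff ℝ 1 h := contDiff_id.sub (χ.contDiff.smul hq)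
  have hh0 : ∀ x, h x ≠ 0 := by
    intro x h0
    have hx : x = χ x • q x := sub_eq_zero.1 h0
    rcases le_or_gt ‖x‖ (C + 1) with hle | hgt
    · have hx' : x ∈ closedBall (0 : E) (C + 1) := by simpa using hle
      rw [χ.one_of_mem_closedBall hx', one_smul] at hx
      have h1 := hδ x hx'
      have h2 := (hqf x).1
      rw [← hx, norm_sub_rev] at h2
      linarith
    · have : ‖x‖ ≤ 1 * (C + 1) := by
        conv_lhs => rw [hx]
        rw [norm_smul, Real.norm_of_nonneg χ.nonneg]
        exact mul_le_mul χ.le_one (hqC x) (norm_nonneg _) zero_le_one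
      linarith
  have hρ : 0 < 2 * (C + 1) := by positivity
  refine no_contDiff_retraction hρ (r := fun x => (2 * (C + 1) * ‖h x‖⁻¹) • h x) ?_ ?_ ?_
  · exact (contDiff_const.mul ((hh.norm ℝ hh0).inv fun x => norm_ne_zero_iff.2 (hh0 x))).smul hh
  · intro x
    rw [norm_smul, norm_mul, norm_inv, norm_norm, mul_assoc,
      inv_mul_cancel₀ (norm_ne_zero_iff.2 (hh0 x)), mul_one, Real.norm_of_nonneg hρ.le]
  · intro x hx
    have h1 : h x = x := by
      simp only [h]
      rw [χ.zero_of_le_dist (by simp [χ, hx]), zero_smul, sub_zero]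
    simp only [h1, hx, mul_inv_cancel₀ hρ.ne', one_smul]

/-- The radial retraction onto the closed unit ball. -/
noncomputable def radialProj {E : Type*} [NormedAddCommGroup E] [NormedSpace ℝ E] (x : E) : E :=
  (max 1 ‖x‖)⁻¹ • x

theorem continuous_radialProj {E : Type*} [NormedAddCommGroup E] [NormedSpace ℝ E] :
    Continuous (radialProj : E → E) := by
  unfold radialProj
  refine Continuous.smul (Continuous.inv₀ (by fun_prop) fun x => ?_) continuous_id
  positivity

theorem norm_radialProj_le {E : Type*} [NormedAddCommGroup E] [NormedSpace ℝ E] (x : E) :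
    ‖radialProj x‖ ≤ 1 := by
  rw [radialProj, norm_smul, norm_inv, Real.norm_of_nonneg (by positivity),
    inv_mul_le_iff₀ (by positivity), mul_one]
  exact le_max_right _ _

theorem radialProj_of_norm_le {E : Type*} [NormedAddCommGroup E] [NormedSpace ℝ E] {x : E}
    (hx : ‖x‖ ≤ 1) : radialProj x = x := by
  rw [radialProj, max_eq_left hx, inv_one, one_smul]

theorem exists_zero_of_norm_sub_le {E : Type*} [NormedAddCommGroup E] [InnerProductSpace ℝ E]
    [FiniteDimensional ℝ E] {h : E → E} (hh : ContinuousOn h (closedBall 0 1))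
    (hle : ∀ x ∈ closedBall (0 : E) 1, ‖x - h x‖ ≤ 1) : ∃ x ∈ closedBall (0 : E) 1, h x = 0 := by
  have hmem : ∀ x : E, radialProj x ∈ closedBall (0 : E) 1 := fun x => by
    simpa using norm_radialProj_le x
  obtain ⟨x, hx⟩ := exists_fixedPoint_of_bounded
    (f := fun x => radialProj x - h (radialProj x)) (C := 1)
    (continuous_radialProj.sub (hh.comp_continuous continuous_radialProj hmem))
    fun x => hle _ (hmem x)
  have hx1 : ‖x‖ ≤ 1 := by
    rw [← hx]; exact hle _ (hmem x)
  rw [radialProj_of_norm_le hx1] at hx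
  exact ⟨x, by simpa using hx1, by simpa using hx⟩

/-- An approximation of a continuous map that avoids `0` on a compact set `S` can be chosen to avoid `0`
on `S` together with any given sphere. -/
theorem exists_continuous_approx_ne_zero {E : Type*} [NormedAddCommGroup E] [InnerProductSpace ℝ E]
    [FiniteDimensional ℝ E] [Nontrivial E] {G : E → E} (hG : Continuous G) {S : Set E}
    (hS : IsCompact S) (hGS : ∀ y ∈ S, G y ≠ 0) (c : E) (ε : ℝ) {η : ℝ} (hη : 0 < η) :
    ∃ P : E → E, Continuous P ∧ (∀ y, ‖P y - G y‖ < η) ∧ (∀ y ∈ S, P y ≠ 0) ∧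
      ∀ y ∈ sphere c ε, P y ≠ 0 := by
  let : MeasurableSpace E := borel E
  have : BorelSpace E := ⟨rfl⟩
  obtain ⟨δ, hδ0, hδη, hδ⟩ : ∃ δ > 0, δ ≤ η ∧ ∀ y ∈ S, δ ≤ ‖G y‖ := by
    rcases S.eq_empty_or_nonempty with rfl | hne
    · exact ⟨η, hη, le_rfl, by simp⟩
    · obtain ⟨y₀, hy₀, hmin⟩ := hS.exists_isMinOn hne (f := fun y => ‖G y‖) (by fun_prop)
      refine ⟨min η ‖G y₀‖, lt_min hη (norm_pos_iff.2 (hGS _ hy₀)), min_le_left _ _,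
        fun y hy => (min_le_right _ _).trans (hmin hy)⟩
  obtain ⟨Q, hQ, hQG, -⟩ := hG.exists_contDiff_approx 1
    (ε := fun _ => δ / 2) continuous_const (fun _ => by positivity)
  simp only [dist_eq_norm] at hQG
  obtain ⟨v, hv, hvQ⟩ : ∃ v ∈ ball (0 : E) (δ / 2), v ∉ Q '' sphere c ε := by
    by_contra! hcon
    have h0 : volume (Q '' sphere c ε) = 0 :=
      addHaar_image_eq_zero_of_differentiableOn_of_addHaar_eq_zero volume
        (hQ.differentiable one_ne_zero).differentiableOn (Measure.addHaar_sphere volume c ε)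
    exact (measure_ball_pos volume (0 : E) (by positivity : 0 < δ / 2)).ne'
      (measure_mono_null hcon h0)
  rw [mem_ball_zero_iff] at hv
  have hlt : ∀ y, ‖Q y - v - G y‖ < δ := by
    intro y
    calc ‖Q y - v - G y‖ = ‖(Q y - G y) - v‖ := by congr 1; abel
      _ ≤ ‖Q y - G y‖ + ‖v‖ := norm_sub_le _ _
      _ < δ := by linarith [hQG y]
  refine ⟨fun y => Q y - v, by fun_prop, fun y => (hlt y).trans_le hδη, ?_, ?_⟩
  · intro y hy h0
    have := hlt y
    simp only [h0, zero_sub, norm_neg] at this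
    exact absurd (hδ y hy) (not_le.2 this)
  · intro y hy h0
    exact hvQ ⟨y, hy, sub_eq_zero.1 h0⟩

/-- **Invariance of domain** (after Kulpa): a continuous injective image of a closed ball contains
the image of the center in its interior. -/
theorem mem_interior_image_closedBall {E : Type*} [NormedAddCommGroup E] [InnerProductSpace ℝ E]
    [FiniteDimensional ℝ E] [Nontrivial E] {f : E → E} (hf : ContinuousOn f (closedBall 0 1))
    (hinj : InjOn f (closedBall 0 1)) : f 0 ∈ interior (f '' closedBall 0 1) := by
  have h01 : (0 : E) ∈ closedBall (0 : E) 1 := by simp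
  by_contra hint
  set K := f '' closedBall 0 1 with hKdef
  have hKc : IsCompact K := (isCompact_closedBall 0 1).image_of_continuousOn hf
  obtain ⟨G, hG, hGf⟩ : ∃ G : E → E, Continuous G ∧ ∀ x ∈ closedBall (0 : E) 1, G (f x) = x := by
    have hcomp : CompactSpace (closedBall (0 : E) 1) :=
      isCompact_iff_compactSpace.1 (isCompact_closedBall _ _)
    have he : Topology.IsClosedEmbedding ((closedBall (0 : E) 1).domRestrict f) :=
      Continuous.isClosedEmbedding hf.domRestrict (injOn_iff_injective.1 hinj)
    have : TietzeExtension E := TietzeExtension.of_tvs ℝ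
    obtain ⟨g, hg⟩ := ContinuousMap.exists_extension he
      ⟨fun x : closedBall (0 : E) 1 => (x : E), continuous_subtype_val⟩
    exact ⟨g, g.continuous, fun x hx => congrArg (fun φ => φ ⟨x, hx⟩) hg⟩
  obtain ⟨ε, hε, hGε⟩ : ∃ ε > 0, ∀ y, ‖y - f 0‖ ≤ 2 * ε → ‖G y‖ ≤ 1 / 10 := by
    obtain ⟨ε, hε, h⟩ := Metric.continuous_iff.1 hG (f 0) (1 / 10) (by norm_num)
    refine ⟨ε / 4, by positivity, fun y hy => ?_⟩
    have := h y (by rw [dist_eq_norm]; linarith)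
    rw [hGf 0 h01, dist_zero_right] at this
    exact this.le
  obtain ⟨c, hc, hcK⟩ : ∃ c ∈ ball (f 0) ε, c ∉ K := by
    by_contra! hcon
    exact hint (mem_interior.2 ⟨_, hcon, isOpen_ball, mem_ball_self hε⟩)
  rw [mem_ball, dist_eq_norm] at hc
  have hS : ∀ y ∈ K \ ball c ε, G y ≠ 0 := by
    rintro _ ⟨⟨x, hx, rfl⟩, hy⟩ h0
    rw [hGf x hx] at h0
    subst h0
    exact hy (by rwa [mem_ball, dist_eq_norm, norm_sub_rev])
  obtain ⟨P, hP, hPG, hPS, hPs⟩ := exists_continuous_approx_ne_zero hG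
    (hKc.diff isOpen_ball) hS c ε (show (0 : ℝ) < 1 / 10 by norm_num)
  let Φ : E → E := fun y => c + max 1 (ε / ‖y - c‖) • (y - c)
  have hne : ∀ y ∈ K, ‖y - c‖ ≠ 0 := fun y hy h =>
    hcK (by rwa [← sub_eq_zero.1 (norm_eq_zero.1 h)])
  have hΦc : ContinuousOn Φ K := by
    refine continuousOn_const.add (ContinuousOn.smul ?_ (by fun_prop))
    exact continuousOn_const.sup (continuousOn_const.div (by fun_prop) hne)
  have hΦfar : ∀ y ∈ K, ε ≤ ‖y - c‖ → Φ y = y := by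
    intro y _ h
    simp only [Φ]
    rw [max_eq_left ((div_le_one (hε.trans_le h)).2 h), one_smul, add_sub_cancel]
  have hΦnear : ∀ y ∈ K, ‖y - c‖ < ε → ‖Φ y - c‖ = ε := by
    intro y hy h
    have hpos : 0 < ‖y - c‖ := (norm_nonneg _).lt_of_ne' (hne y hy)
    simp only [Φ]
    rw [max_eq_right ((one_le_div hpos).2 h.le), add_sub_cancel_left, norm_smul,
      Real.norm_of_nonneg (by positivity), div_mul_cancel₀ _ hpos.ne']
  obtain ⟨x, hx, hx0⟩ := exists_zero_of_norm_sub_le (h := fun x => P (Φ (f x)))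
    (hP.comp_continuousOn (hΦc.comp hf (mapsTo_image _ _))) (by
      intro x hx
      have hy : f x ∈ K := mem_image_of_mem _ hx
      rcases le_or_gt ε ‖f x - c‖ with h | h
      · have := hPG (f x)
        rw [hGf x hx, norm_sub_rev] at this
        rw [hΦfar _ hy h]
        linarith
      · have h1 : ‖x‖ ≤ 1 / 10 := by
          rw [← hGf x hx]
          refine hGε _ ?_
          calc ‖f x - f 0‖ = ‖(f x - c) + (c - f 0)‖ := by simp
            _ ≤ _ := norm_add_le _ _
            _ ≤ 2 * ε := by linarith
        have h2 : ‖G (Φ (f x))‖ ≤ 1 / 10 := by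
          refine hGε _ ?_
          calc ‖Φ (f x) - f 0‖ = ‖(Φ (f x) - c) + (c - f 0)‖ := by simp
            _ ≤ _ := norm_add_le _ _
            _ ≤ 2 * ε := by linarith [hΦnear _ hy h]
        calc ‖x - P (Φ (f x))‖ = ‖x - (P (Φ (f x)) - G (Φ (f x))) - G (Φ (f x))‖ := by
              congr 1; abel
          _ ≤ ‖x‖ + ‖P (Φ (f x)) - G (Φ (f x))‖ + ‖G (Φ (f x))‖ :=
              (norm_sub_le _ _).trans (by gcongr; exact norm_sub_le _ _)
          _ ≤ 1 := by linarith [hPG (Φ (f x))])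
  have hy : f x ∈ K := mem_image_of_mem _ hx
  rcases le_or_gt ε ‖f x - c‖ with h | h
  · refine hPS (f x) ⟨hy, by simpa [dist_eq_norm] using h⟩ ?_
    rwa [hΦfar _ hy h] at hx0
  · exact hPs _ (by rw [mem_sphere, dist_eq_norm, hΦnear _ hy h]) hx0

theorem exists_real_lift_of_even {c : sphere (0 : EuclideanSpace ℝ (Fin 4)) 1 → Circle}
    (hc : Continuous c) (heven : ∀ q, c (-q) = c q) :
    ∃ Θ : sphere (0 : EuclideanSpace ℝ (Fin 4)) 1 → ℝ,
      Continuous Θ ∧ ∀ q, Circle.exp (Θ q) = c q := by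
  -- parametrize the upper hemisphere by the closed unit ball of `ℝ³`, and lift over the ball
  let A : EuclideanSpace ℝ (Fin 3) → EuclideanSpace ℝ (Fin 4) :=
    fun v => !₂[√(1 - ‖v‖ ^ 2), v 0, v 1, v 2]
  have hAc : Continuous A := by
    refine (PiLp.continuous_toLp 2 _).comp (continuous_pi fun i => ?_)
    fin_cases i <;> simp <;> fun_prop
  have hAn : ∀ v, ‖A v‖ ^ 2 = max 1 (‖v‖ ^ 2) := by
    intro v
    rw [EuclideanSpace.real_norm_sq_eq, Fin.sum_univ_four]
    have hv : ‖v‖ ^ 2 = v 0 ^ 2 + v 1 ^ 2 + v 2 ^ 2 := by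
      rw [EuclideanSpace.real_norm_sq_eq, Fin.sum_univ_three]
    simp only [A, Matrix.cons_val]
    rcases le_total (‖v‖ ^ 2) 1 with h | h
    · rw [Real.sq_sqrt (by linarith), max_eq_left h]; linarith
    · rw [Real.sqrt_eq_zero_of_nonpos (by linarith), max_eq_right h]; linarith
  have hA1 : ∀ v, 1 ≤ ‖A v‖ := fun v => by
    have : (1 : ℝ) ≤ ‖A v‖ ^ 2 := (hAn v).symm ▸ le_max_left _ _
    nlinarith [norm_nonneg (A v)]
  have hA0 : ∀ v, ‖A v‖ ≠ 0 := fun v => (zero_lt_one.trans_le (hA1 v)).ne'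
  let p : EuclideanSpace ℝ (Fin 3) → sphere (0 : EuclideanSpace ℝ (Fin 4)) 1 :=
    fun v => ⟨‖A v‖⁻¹ • A v, by
      rw [mem_sphere_zero_iff_norm, norm_smul, norm_inv, norm_norm, inv_mul_cancel₀ (hA0 v)]⟩
  have hpc : Continuous p := by
    exact Continuous.subtype_mk ((hAc.norm.inv₀ hA0).smul hAc) _
  have hpA : ∀ (v) (q : sphere (0 : EuclideanSpace ℝ (Fin 4)) 1), A v = q → p v = q := by
    intro v q h
    ext1
    simp only [p, h, norm_eq_of_mem_sphere, inv_one, one_smul]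
  let im : EuclideanSpace ℝ (Fin 4) → EuclideanSpace ℝ (Fin 3) := fun q => !₂[q 1, q 2, q 3]
  have him : Continuous im := by
    refine (PiLp.continuous_toLp 2 _).comp (continuous_pi fun i => ?_)
    fin_cases i <;> simp <;> fun_prop
  have himneg : ∀ q, im (-q) = -im q := by
    intro q; ext i; fin_cases i <;> simp [im]
  have hnorm : ∀ q : sphere (0 : EuclideanSpace ℝ (Fin 4)) 1,
      (q : EuclideanSpace ℝ (Fin 4)) 0 ^ 2 + ‖im q‖ ^ 2 = 1 := by
    intro q
    have h := EuclideanSpace.real_norm_sq_eq (q : EuclideanSpace ℝ (Fin 4))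
    rw [norm_eq_of_mem_sphere, Fin.sum_univ_four] at h
    rw [EuclideanSpace.real_norm_sq_eq, Fin.sum_univ_three]
    simp only [im, Matrix.cons_val]
    linarith
  have hpim : ∀ q : sphere (0 : EuclideanSpace ℝ (Fin 4)) 1,
      0 ≤ (q : EuclideanSpace ℝ (Fin 4)) 0 → p (im q) = q := by
    intro q hq
    apply hpA
    have h : √(1 - ‖im q‖ ^ 2) = (q : EuclideanSpace ℝ (Fin 4)) 0 := by
      rw [← eq_sub_of_add_eq (hnorm q), Real.sqrt_sq hq]
    ext i; fin_cases i <;> simp [A, h] <;> simp [im]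
  obtain ⟨t₀, ht₀⟩ := Circle.exp_surjective (c (p 0))
  obtain ⟨θ, ⟨-, hθ⟩, -⟩ := Circle.isCoveringMap_exp.existsUnique_continuousMap_lifts
    ⟨fun v => c (p v), hc.comp hpc⟩ 0 t₀ ht₀
  have hθ' : ∀ v, Circle.exp (θ v) = c (p v) := fun v => congrFun hθ v
  have hsymm : ∀ v, ‖v‖ = 1 → θ (-v) = θ v := by
    have hpneg : ∀ v, ‖v‖ = 1 → p (-v) = -p v := by
      intro v hv
      apply hpA
      have hAv : A (-v) = -A v := by
        ext i; fin_cases i <;> simp [A, hv]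
      have : ‖A v‖ = 1 := by
        have := hAn v
        rw [hv] at this
        norm_num at this
        rcases this with h | h
        · exact h
        · linarith [norm_nonneg (A v)]
      simp [p, hAv, this]
    have hint : ∀ v, ‖v‖ = 1 → ∃ m : ℤ, θ v - θ (-v) = m * (2 * Real.pi) := by
      intro v hv
      have : Circle.exp (θ v) = Circle.exp (θ (-v)) := by
        rw [hθ', hθ', hpneg v hv, heven]
      obtain ⟨m, hm⟩ := Circle.exp_eq_exp.1 this
      exact ⟨m, by linarith⟩
    have hpre : IsPreconnected (sphere (0 : EuclideanSpace ℝ (Fin 3)) 1) :=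
      isPreconnected_sphere (by
        rw [← Module.finrank_eq_rank, finrank_euclideanSpace_fin]; norm_num) _ _
    intro v hv
    have hconst := hpre.constant_of_mapsTo 
      (T := AddSubgroup.zmultiples (2 * Real.pi))
      (SetLike.isDiscrete_iff_discreteTopology.2 inferInstance)
      (f := fun w => θ w - θ (-w)) (by fun_prop)
      (fun w hw => by
        obtain ⟨m, hm⟩ := hint w (by simpa using hw)
        exact ⟨m, by simpa using hm.symm⟩)
      (x := v) (y := -v) (by simpa using hv) (by simpa using hv)
    simp only [neg_neg] at hconst
    linarith
  refine ⟨fun q => if 0 ≤ (q : EuclideanSpace ℝ (Fin 4)) 0 then θ (im q) else θ (-im q), ?_, ?_⟩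
  · refine Continuous.if_le (by fun_prop) (by fun_prop) continuous_const (by fun_prop) ?_
    intro q hq
    refine (hsymm _ ?_).symm
    have := hnorm q
    rw [← hq] at this
    norm_num at this
    rcases this with h | h
    · exact h
    · linarith [norm_nonneg (im q)]
  · intro q
    dsimp only
    split_ifs with h
    · rw [hθ', hpim q h]
    · have h' : 0 ≤ (-q).1 0 := by
        simpa using (not_le.1 h).le
      rw [hθ', ← himneg, ← heven q, ← hpim _ h']
      simp

/-- The rotation matrix attached to a unit quaternion `a + b i + c j + d k`. -/
def rotationOfUnit (q : sphere (0 : EuclideanSpace ℝ (Fin 4)) 1) : SO3 :=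
  let a := q.1 0
  let b := q.1 1
  let c := q.1 2
  let d := q.1 3
  ⟨!![a ^ 2 + b ^ 2 - c ^ 2 - d ^ 2, 2 * (b * c - a * d), 2 * (b * d + a * c);
      2 * (b * c + a * d), a ^ 2 - b ^ 2 + c ^ 2 - d ^ 2, 2 * (c * d - a * b);
      2 * (b * d - a * c), 2 * (c * d + a * b), a ^ 2 - b ^ 2 - c ^ 2 + d ^ 2], by
    have h : a ^ 2 + b ^ 2 + c ^ 2 + d ^ 2 = 1 := by
      have h := EuclideanSpace.real_norm_sq_eq q.1
      rw [norm_eq_of_mem_sphere, Fin.sum_univ_four] at h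
      linarith
    have h2 : (a ^ 2 + b ^ 2 + c ^ 2 + d ^ 2) ^ 2 = 1 := by rw [h, one_pow]
    have h3 : (a ^ 2 + b ^ 2 + c ^ 2 + d ^ 2) ^ 3 = 1 := by rw [h, one_pow]
    constructor
    · ext i j
      fin_cases i <;> fin_cases j <;> simp [Matrix.mul_apply, Fin.sum_univ_three] <;>
        first
        | ring1
        | linear_combination h2
    · rw [Matrix.det_fin_three]
      simp only [Matrix.of_apply, Matrix.cons_val]
      linear_combination h3⟩

theorem continuous_rotationOfUnit : Continuous rotationOfUnit := by
  refine Continuous.subtype_mk (continuous_matrix fun i j => ?_) _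
  fin_cases i <;> fin_cases j <;> simp <;> fun_prop

theorem rotationOfUnit_neg (q : sphere (0 : EuclideanSpace ℝ (Fin 4)) 1) :
    rotationOfUnit (-q) = rotationOfUnit q := by
  simp [rotationOfUnit]
  rfl

theorem eq_or_eq_neg_of_rotationOfUnit_eq {q r : sphere (0 : EuclideanSpace ℝ (Fin 4)) 1}
    (h : rotationOfUnit q = rotationOfUnit r) : q = r ∨ q = -r := by
  have hq := EuclideanSpace.real_norm_sq_eq q.1
  have hr := EuclideanSpace.real_norm_sq_eq r.1
  rw [norm_eq_of_mem_sphere, Fin.sum_univ_four] at hq hr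
  have hM := fun i j => congrFun (congrFun (congrArg Subtype.val h) i) j
  have e00 := hM 0 0
  have e01 := hM 0 1
  have e02 := hM 0 2
  have e10 := hM 1 0
  have e11 := hM 1 1
  have e12 := hM 1 2
  have e20 := hM 2 0
  have e21 := hM 2 1
  have e22 := hM 2 2
  simp only [rotationOfUnit, Matrix.of_apply, Matrix.cons_val]
    at e00 e01 e02 e10 e11 e12 e20 e21 e22
  have hprod : ∀ i j, q.1 i * q.1 j = r.1 i * r.1 j := by
    intro i j
    fin_cases i <;> fin_cases j <;> simp <;> linarith
  set s := ∑ j, q.1 j * r.1 j with hs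
  have hsr : ∀ i, s * r.1 i = q.1 i := by
    intro i
    have : s * r.1 i = (∑ j, q.1 j ^ 2) * q.1 i := by
      rw [hs, Finset.sum_mul, Finset.sum_mul]
      refine Finset.sum_congr rfl fun j _ => ?_
      linear_combination -q.1 j * hprod j i
    rw [this, Fin.sum_univ_four]
    linear_combination -q.1 i * hq
  have hs2 : s ^ 2 = 1 := by
    have : s ^ 2 = ∑ j, q.1 j ^ 2 := by
      rw [sq]
      nth_rewrite 2 [hs]
      rw [Finset.mul_sum]
      refine Finset.sum_congr rfl fun j _ => ?_
      linear_combination q.1 j * hsr j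
    rw [this, Fin.sum_univ_four]
    linarith
  rcases sq_eq_one_iff.1 hs2 with h1 | h1
  · left
    ext i
    rw [← hsr i, h1, one_mul]
  · right
    ext i
    rw [← hsr i, h1]
    simp

/-- The radial projection of an affine hyperplane tangent to the sphere gives injective charts. -/
theorem exists_sphere_chart (q₀ : sphere (0 : EuclideanSpace ℝ (Fin 4)) 1) :
    ∃ φ : EuclideanSpace ℝ (Fin 3) → sphere (0 : EuclideanSpace ℝ (Fin 4)) 1,
      Continuous φ ∧ φ 0 = q₀ ∧ ∀ u v, φ u = φ v ∨ φ u = -φ v → u = v := by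
  have hfact : Fact (Module.finrank ℝ (EuclideanSpace ℝ (Fin 4)) = 3 + 1) := ⟨by simp⟩
  let L := (OrthonormalBasis.fromOrthogonalSpanSingleton (𝕜 := ℝ) 3
    (ne_zero_of_mem_unit_sphere q₀)).repr.symm
  let A : EuclideanSpace ℝ (Fin 3) → EuclideanSpace ℝ (Fin 4) := fun u => q₀ + L u
  have hAc : Continuous A := by fun_prop
  have hin : ∀ u, inner ℝ (q₀ : EuclideanSpace ℝ (Fin 4)) (A u) = 1 := by
    intro u
    have h1 : inner ℝ (q₀ : EuclideanSpace ℝ (Fin 4)) (L u : EuclideanSpace ℝ (Fin 4)) = 0 :=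
      Submodule.mem_orthogonal_singleton_iff_inner_right.1 (L u).2
    rw [inner_add_right, h1, real_inner_self_eq_norm_sq, norm_eq_of_mem_sphere]
    norm_num
  have hA0 : ∀ u, ‖A u‖ ≠ 0 := by
    intro u h
    have := hin u
    rw [norm_eq_zero.1 h, inner_zero_right] at this
    exact zero_ne_one this
  refine ⟨fun u => ⟨‖A u‖⁻¹ • A u, by
      rw [mem_sphere_zero_iff_norm, norm_smul, norm_inv, norm_norm, inv_mul_cancel₀ (hA0 u)]⟩,
    ?_, ?_, ?_⟩
  · exact Continuous.subtype_mk ((hAc.norm.inv₀ hA0).smul hAc) _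
  · ext1
    simp [A]
  · intro u v huv
    have key : ∀ σ : ℝ, ‖A u‖⁻¹ • A u = σ • ‖A v‖⁻¹ • A v → A u = A v := by
      intro σ h
      have h1 := congrArg (fun x => inner ℝ (q₀ : EuclideanSpace ℝ (Fin 4)) x) h
      simp only [inner_smul_right, hin, mul_one] at h1
      rw [smul_smul, ← h1] at h
      exact smul_right_injective _ (inv_ne_zero (hA0 u)) h
    have hAA : A u = A v := by
      rcases huv with h | h
      · exact key 1 (by simpa using congrArg Subtype.val h)
      · exact key (-1) (by simpa using congrArg Subtype.val h)
    exact L.injective (Subtype.ext (add_left_cancel hAA))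

/-- There is no topological embedding of `SO(3)` into `S² × S¹`. -/
theorem no_embedding_SO3_into_sphere2_prod_circle :
    ¬ ∃ f : SO3 →
        (Metric.sphere (0 : EuclideanSpace ℝ (Fin 3)) 1) ×
        (Metric.sphere (0 : EuclideanSpace ℝ (Fin 2)) 1),
      Topology.IsEmbedding f := by
  rintro ⟨f, hf⟩
  let L := Complex.orthonormalBasisOneI.repr.symm
  let toC : sphere (0 : EuclideanSpace ℝ (Fin 2)) 1 → Circle := fun x =>
    ⟨L x, mem_sphere_zero_iff_norm.2 (by rw [L.norm_map, norm_eq_of_mem_sphere])⟩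
  have htoC : Continuous toC :=
    Continuous.subtype_mk (L.continuous.comp continuous_subtype_val) _
  have htoCinj : Function.Injective toC := fun x y h =>
    Subtype.ext (L.injective (congrArg Subtype.val h))
  obtain ⟨Θ, hΘ, hexp⟩ := exists_real_lift_of_even
    (c := fun q => toC (f (rotationOfUnit q)).2)
    (htoC.comp (continuous_snd.comp (hf.continuous.comp continuous_rotationOfUnit)))
    (fun q => by rw [rotationOfUnit_neg])
  let G : sphere (0 : EuclideanSpace ℝ (Fin 4)) 1 → EuclideanSpace ℝ (Fin 3) :=
    fun q => Real.exp (Θ q) • ((f (rotationOfUnit q)).1 : EuclideanSpace ℝ (Fin 3))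
  have hG : Continuous G := (Real.continuous_exp.comp hΘ).smul (continuous_subtype_val.comp
    (continuous_fst.comp (hf.continuous.comp continuous_rotationOfUnit)))
  have hGinj : ∀ q r, G q = G r → q = r ∨ q = -r := by
    intro q r h
    have hn : Real.exp (Θ q) = Real.exp (Θ r) := by
      have := congrArg norm h
      simpa only [G, norm_smul, norm_eq_of_mem_sphere, mul_one, Real.norm_eq_abs,
        Real.abs_exp] using this
    have h1 : (f (rotationOfUnit q)).1 = (f (rotationOfUnit r)).1 := by
      simp only [G, hn] at h
      exact Subtype.ext (smul_right_injective _ (Real.exp_pos _).ne' h)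
    have h2 : (f (rotationOfUnit q)).2 = (f (rotationOfUnit r)).2 :=
      htoCinj (by rw [← hexp, ← hexp, Real.exp_injective hn])
    exact eq_or_eq_neg_of_rotationOfUnit_eq (hf.injective (Prod.ext h1 h2))
  have hcompact : IsCompact (range G) := isCompact_range hG
  have hopen : IsOpen (range G) := by
    rw [← subset_interior_iff_isOpen]
    rintro _ ⟨q, rfl⟩
    obtain ⟨φ, hφ, rfl, hφinj⟩ := exists_sphere_chart q
    refine interior_mono ?_ (mem_interior_image_closedBall (hG.comp hφ).continuousOn
      fun u _ v _ h => hφinj u v (hGinj _ _ h))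
    rintro _ ⟨u, -, rfl⟩
    exact ⟨φ u, rfl⟩
  have hne : (range G).Nonempty :=
    ⟨_, ⟨EuclideanSpace.single 0 1, by simp⟩, rfl⟩
  have huniv : range G = univ := IsClopen.eq_univ ⟨hcompact.isClosed, hopen⟩ hne
  exact noncompact_univ _ (huniv ▸ hcompact)
end
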